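/- arXiv:2112.14625 — 2 statements merged into one kernel-verified Lean document; each statement's English description precedes it below -/
import Mathlib

section
/- Let α > 1 and let τ(ξ) = 2(1+α)·S(ρξ) be the function defined from the WKB integral S. Then lim_{ξ→1⁺} τ′(ξ) = (1+α)^{3/2}/(√2·α); moreover τ is strictly increasing on [1,∞) and inf_{ξ∈[1,∞)} ξ^{−(1+α)/(2α)}·Dτ(ξ) > 0, where D = ξ d/dξ. -/
open Real MeasureTheory Set Filter Topology Asymptotics

noncomputable section

/-- The Euler operator D = x d/dx, with the derivative taken within a set. -/
def eulerDW (s : Set ℝ) (f : ℝ → ℝ) : ℝ → ℝ := fun x => x * derivWithin f s x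

/-- V(u;x) = x u² − u^{2α+2} − 1. -/
def Vfun (α x u : ℝ) : ℝ := x * u ^ 2 - u ^ (2 * α + 2) - 1

/-- ρ = ((α+1)/α)·α^{1/(α+1)}. -/
def rhoC (α : ℝ) : ℝ := ((α + 1) / α) * α ^ (1 / (α + 1))

/-- The smaller positive root u₁(x) of V(·;x). -/
def u1F (α x : ℝ) : ℝ := sInf {u : ℝ | 0 < u ∧ Vfun α x u = 0}

/-- The larger positive root u₂(x) of V(·;x). -/
def u2F (α x : ℝ) : ℝ := sSup {u : ℝ | 0 < u ∧ Vfun α x u = 0}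

/-- The WKB integral S(x). -/
def Sfun (α x : ℝ) : ℝ :=
  if rhoC α < x then (1/π) * ∫ u in u1F α x..u2F α x, Real.sqrt (Vfun α x u) / u else 0

/-- τ(ξ) = 2(1+α)·S(ρξ). -/
def tauF (α ξ : ℝ) : ℝ := 2 * (1 + α) * Sfun α (rhoC α * ξ)

/-- The potential `u ^ (2 * α) + u⁻²` in the logarithmic variable, with its minimum moved to
`v = 0` and normalized to `1`. -/
def normPotential (α v : ℝ) : ℝ := (exp (2 * α * v) + α * exp (-2 * v)) / (1 + α)

/-- The derivative of `normPotential`. -/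
def normPotentialDeriv (α v : ℝ) : ℝ :=
  2 * α / (1 + α) * (exp (2 * α * v) - exp (-2 * v))

/-- The signed square root of `normPotential - 1`. -/
def morseCoord (α v : ℝ) : ℝ := Real.sign v * √(normPotential α v - 1)

/-- The derivative of `morseCoord`. -/
def morseCoordDeriv (α v : ℝ) : ℝ :=
  if v = 0 then √(2 * α) else normPotentialDeriv α v / (2 * morseCoord α v)

section Morse

variable {α : ℝ}

lemma normPotential_zero (hα : 1 < α) : normPotential α 0 = 1 := by
  have : 1 + α ≠ 0 := by positivity
  simp [normPotential, this]

lemma one_lt_normPotential (hα : 1 < α) {v : ℝ} (hv : v ≠ 0) : 1 < normPotential α v := by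
  have h1 := add_one_lt_exp (x := 2 * α * v) (by positivity)
  have h2 := add_one_lt_exp (x := -2 * v) (by simpa using hv)
  rw [normPotential, lt_div_iff₀ (by positivity)]
  nlinarith

lemma one_le_normPotential (hα : 1 < α) (v : ℝ) : 1 ≤ normPotential α v := by
  rcases eq_or_ne v 0 with rfl | hv
  · exact (normPotential_zero hα).ge
  · exact (one_lt_normPotential hα hv).le

lemma hasDerivAt_normPotential (α v : ℝ) :
    HasDerivAt (normPotential α) (normPotentialDeriv α v) v := by
  have h1 : HasDerivAt (fun v => exp (2 * α * v)) (exp (2 * α * v) * (2 * α)) v := by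
    simpa using ((hasDerivAt_id v).const_mul (2 * α)).exp
  have h2 : HasDerivAt (fun v => exp (-2 * v)) (exp (-2 * v) * (-2)) v := by
    simpa using ((hasDerivAt_id v).const_mul (-2)).exp
  refine ((h1.add (h2.const_mul α)).div_const (1 + α)).congr_deriv ?_
  rw [normPotentialDeriv]
  ring

lemma hasDerivAt_normPotentialDeriv (α v : ℝ) :
    HasDerivAt (normPotentialDeriv α)
      (2 * α / (1 + α) * (exp (2 * α * v) * (2 * α) + exp (-2 * v) * 2)) v := by
  have h1 : HasDerivAt (fun v => exp (2 * α * v)) (exp (2 * α * v) * (2 * α)) v := by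
    simpa using ((hasDerivAt_id v).const_mul (2 * α)).exp
  have h2 : HasDerivAt (fun v => exp (-2 * v)) (exp (-2 * v) * (-2)) v := by
    simpa using ((hasDerivAt_id v).const_mul (-2)).exp
  refine ((h1.sub h2).const_mul (2 * α / (1 + α))).congr_deriv ?_
  ring

lemma continuous_normPotential (α : ℝ) : Continuous (normPotential α) :=
  continuous_iff_continuousAt.2 fun v => (hasDerivAt_normPotential α v).continuousAt

lemma continuous_normPotentialDeriv (α : ℝ) : Continuous (normPotentialDeriv α) :=
  continuous_iff_continuousAt.2 fun v => (hasDerivAt_normPotentialDeriv α v).continuousAt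

lemma normPotentialDeriv_pos (hα : 1 < α) {v : ℝ} (hv : 0 < v) : 0 < normPotentialDeriv α v := by
  have : exp (-2 * v) < exp (2 * α * v) := exp_lt_exp.2 (by nlinarith)
  exact mul_pos (by positivity) (by linarith)

lemma normPotentialDeriv_neg (hα : 1 < α) {v : ℝ} (hv : v < 0) : normPotentialDeriv α v < 0 := by
  have : exp (2 * α * v) < exp (-2 * v) := exp_lt_exp.2 (by nlinarith)
  exact mul_neg_of_pos_of_neg (by positivity) (by linarith)

lemma morseCoord_of_pos {v : ℝ} (hv : 0 < v) :
    morseCoord α v = √(normPotential α v - 1) := by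
  rw [morseCoord, Real.sign_of_pos hv, one_mul]

lemma morseCoord_of_neg {v : ℝ} (hv : v < 0) :
    morseCoord α v = -√(normPotential α v - 1) := by
  rw [morseCoord, Real.sign_of_neg hv, neg_one_mul]

@[simp] lemma morseCoord_zero (α : ℝ) : morseCoord α 0 = 0 := by simp [morseCoord]

lemma morseCoord_sq (hα : 1 < α) (v : ℝ) : morseCoord α v ^ 2 = normPotential α v - 1 := by
  have h := sub_nonneg.2 (one_le_normPotential hα v)
  rcases lt_trichotomy v 0 with hv | rfl | hv
  · rw [morseCoord_of_neg hv, neg_sq, sq_sqrt h]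
  · simp [normPotential_zero hα]
  · rw [morseCoord_of_pos hv, sq_sqrt h]

lemma morseCoord_pos (hα : 1 < α) {v : ℝ} (hv : 0 < v) : 0 < morseCoord α v := by
  rw [morseCoord_of_pos hv]
  exact sqrt_pos.2 (sub_pos.2 (one_lt_normPotential hα hv.ne'))

lemma morseCoord_neg (hα : 1 < α) {v : ℝ} (hv : v < 0) : morseCoord α v < 0 := by
  rw [morseCoord_of_neg hv, neg_lt_zero]
  exact sqrt_pos.2 (sub_pos.2 (one_lt_normPotential hα hv.ne))

lemma morseCoord_ne_zero (hα : 1 < α) {v : ℝ} (hv : v ≠ 0) : morseCoord α v ≠ 0 := by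
  rcases hv.lt_or_gt with h | h
  · exact (morseCoord_neg hα h).ne
  · exact (morseCoord_pos hα h).ne'

lemma morseCoordDeriv_pos (hα : 1 < α) (v : ℝ) : 0 < morseCoordDeriv α v := by
  rcases lt_trichotomy v 0 with hv | rfl | hv
  · rw [morseCoordDeriv, if_neg hv.ne]
    exact div_pos_of_neg_of_neg (normPotentialDeriv_neg hα hv)
      (by linarith [morseCoord_neg hα hv])
  · rw [morseCoordDeriv, if_pos rfl]
    positivity
  · rw [morseCoordDeriv, if_neg hv.ne']
    exact div_pos (normPotentialDeriv_pos hα hv) (by linarith [morseCoord_pos hα hv])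

lemma hasDerivAt_morseCoord_of_ne (hα : 1 < α) {v : ℝ} (hv : v ≠ 0) :
    HasDerivAt (morseCoord α) (morseCoordDeriv α v) v := by
  have h := ((hasDerivAt_normPotential α v).sub_const 1).sqrt
    (sub_pos.2 (one_lt_normPotential hα hv)).ne'
  rw [morseCoordDeriv, if_neg hv]
  rcases hv.lt_or_gt with h0 | h0
  · rw [morseCoord_of_neg h0, mul_neg, div_neg]
    refine h.neg.congr_of_eventuallyEq ?_
    filter_upwards [Iio_mem_nhds h0] with w hw
    exact morseCoord_of_neg hw
  · rw [morseCoord_of_pos h0]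
    refine h.congr_of_eventuallyEq ?_
    filter_upwards [Ioi_mem_nhds h0] with w hw
    exact morseCoord_of_pos hw

lemma continuousAt_morseCoord_zero (hα : 1 < α) : ContinuousAt (morseCoord α) 0 := by
  have h : Tendsto (fun v => √(normPotential α v - 1)) (𝓝 0) (𝓝 0) := by
    have : Continuous fun v => √(normPotential α v - 1) :=
      ((continuous_normPotential α).sub continuous_const).sqrt
    simpa [normPotential_zero hα] using this.tendsto 0
  rw [ContinuousAt, morseCoord_zero]
  refine squeeze_zero_norm (fun v => ?_) h
  rw [norm_eq_abs, ← sqrt_sq_eq_abs, morseCoord_sq hα]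

lemma tendsto_sq_normPotentialDeriv_div (hα : 1 < α) :
    Tendsto (fun v => normPotentialDeriv α v ^ 2 / (4 * (normPotential α v - 1)))
      (𝓝[≠] 0) (𝓝 (2 * α)) := by
  have hne : ∀ᶠ v in 𝓝[≠] (0 : ℝ), normPotentialDeriv α v ≠ 0 := by
    filter_upwards [self_mem_nhdsWithin] with v hv
    rcases (show v ≠ 0 from hv).lt_or_gt with h | h
    · exact (normPotentialDeriv_neg hα h).ne
    · exact (normPotentialDeriv_pos hα h).ne'
  refine HasDerivAt.lhopital_zero_nhdsNE
    (.of_forall fun v => (hasDerivAt_normPotentialDeriv α v).pow 2)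
    (.of_forall fun v => ((hasDerivAt_normPotential α v).sub_const 1).const_mul 4)
    (hne.mono fun v hv => by simpa using hv) ?_ ?_ ?_
  · have h0 : normPotentialDeriv α 0 = 0 := by simp [normPotentialDeriv]
    have : Tendsto (fun v => normPotentialDeriv α v ^ 2) (𝓝 0) (𝓝 (normPotentialDeriv α 0 ^ 2)) :=
      ((continuous_normPotentialDeriv α).pow 2).tendsto 0
    exact tendsto_nhdsWithin_of_tendsto_nhds (by simpa [h0] using this)
  · have := (((continuous_normPotential α).sub (continuous_const (y := 1))).const_mul 4).tendsto 0
    exact tendsto_nhdsWithin_of_tendsto_nhds (by simpa [normPotential_zero hα] using this)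
  · have hc : Continuous fun v : ℝ =>
        α / (1 + α) * (exp (2 * α * v) * (2 * α) + exp (-2 * v) * 2) := by fun_prop
    have h0 : α / (1 + α) * (exp (2 * α * 0) * (2 * α) + exp (-2 * 0) * 2) = 2 * α := by
      simp only [mul_zero, exp_zero]
      field_simp
      ring
    have := hc.tendsto 0
    rw [h0] at this
    refine (tendsto_nhdsWithin_of_tendsto_nhds this).congr' ?_
    filter_upwards [hne] with v hv
    field_simp
    ring

lemma continuousAt_morseCoordDeriv_zero (hα : 1 < α) : ContinuousAt (morseCoordDeriv α) 0 := by
  rw [continuousAt_iff_punctured_nhds, morseCoordDeriv, if_pos rfl]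
  refine (tendsto_sq_normPotentialDeriv_div hα).sqrt.congr' ?_
  filter_upwards [self_mem_nhdsWithin] with v hv
  rw [← sqrt_sq (morseCoordDeriv_pos hα v).le, morseCoordDeriv, if_neg (show v ≠ 0 from hv),
    div_pow, mul_pow, morseCoord_sq hα]
  norm_num

lemma hasDerivAt_morseCoord (hα : 1 < α) (v : ℝ) :
    HasDerivAt (morseCoord α) (morseCoordDeriv α v) v :=
  hasDerivAt_of_hasDerivAt_of_ne' (fun _ => hasDerivAt_morseCoord_of_ne hα)
    (continuousAt_morseCoord_zero hα) (continuousAt_morseCoordDeriv_zero hα) v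

lemma continuous_morseCoord (hα : 1 < α) : Continuous (morseCoord α) :=
  continuous_iff_continuousAt.2 fun v => (hasDerivAt_morseCoord hα v).continuousAt

lemma continuous_morseCoordDeriv (hα : 1 < α) : Continuous (morseCoordDeriv α) := by
  refine continuous_iff_continuousAt.2 fun v => ?_
  rcases eq_or_ne v 0 with rfl | hv
  · exact continuousAt_morseCoordDeriv_zero hα
  · have h : ContinuousAt (fun v => normPotentialDeriv α v / (2 * morseCoord α v)) v :=
      (continuous_normPotentialDeriv α).continuousAt.div
        ((continuous_morseCoord hα).const_mul 2).continuousAt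
        (mul_ne_zero two_ne_zero (morseCoord_ne_zero hα hv))
    refine h.congr ?_
    filter_upwards [isOpen_ne.mem_nhds hv] with w hw
    rw [morseCoordDeriv, if_neg hw]

lemma strictMono_morseCoord (hα : 1 < α) : StrictMono (morseCoord α) :=
  strictMono_of_deriv_pos fun v => by
    rw [(hasDerivAt_morseCoord hα v).deriv]
    exact morseCoordDeriv_pos hα v

lemma surjective_morseCoord (hα : 1 < α) : Function.Surjective (morseCoord α) := by
  refine (continuous_morseCoord hα).surjective ?_ ?_
  · have hlin : Tendsto (fun v : ℝ => 2 * α / (1 + α) * v + (1 / (1 + α) - 1)) atTop atTop :=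
      tendsto_atTop_add_const_right _ _ (tendsto_id.const_mul_atTop (by positivity))
    have h : Tendsto (fun v => normPotential α v - 1) atTop atTop := by
      refine tendsto_atTop_mono (fun v => ?_) hlin
      have h1 := add_one_le_exp (2 * α * v)
      have h2 := exp_pos (-2 * v)
      have : (2 * α * v + 1) / (1 + α) ≤ normPotential α v :=
        div_le_div_of_nonneg_right (by nlinarith) (by positivity)
      calc _ = (2 * α * v + 1) / (1 + α) - 1 := by ring
        _ ≤ _ := by linarith
    refine (tendsto_sqrt_atTop.comp h).congr' ?_
    filter_upwards [eventually_gt_atTop 0] with v hv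
    exact (morseCoord_of_pos hv).symm
  · have hlin : Tendsto (fun v : ℝ => -(2 * α / (1 + α)) * v + (α / (1 + α) - 1)) atBot atTop :=
      tendsto_atTop_add_const_right _ _
        (tendsto_id.const_mul_atBot_of_neg (neg_neg_of_pos (by positivity)))
    have h : Tendsto (fun v => normPotential α v - 1) atBot atTop := by
      refine tendsto_atTop_mono (fun v => ?_) hlin
      have h1 := add_one_le_exp (-2 * v)
      have h2 := exp_pos (2 * α * v)
      have : α * (-2 * v + 1) / (1 + α) ≤ normPotential α v :=
        div_le_div_of_nonneg_right (by nlinarith) (by positivity)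
      calc _ = α * (-2 * v + 1) / (1 + α) - 1 := by ring
        _ ≤ _ := by linarith
    refine (tendsto_neg_atTop_atBot.comp (tendsto_sqrt_atTop.comp h)).congr' ?_
    filter_upwards [eventually_lt_atBot 0] with v hv
    exact (morseCoord_of_neg hv).symm

/-- The inverse function of `morseCoord`. -/
def logAmp (α : ℝ) : ℝ → ℝ := Function.invFun (morseCoord α)

/-- The exponential of `logAmp`: the normalized amplitude `u` as a function of `morseCoord`. -/
def amp (α y : ℝ) : ℝ := exp (logAmp α y)

/-- The derivative of `amp`. -/
def ampDeriv (α y : ℝ) : ℝ := amp α y / morseCoordDeriv α (logAmp α y)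

lemma morseCoord_logAmp (hα : 1 < α) (y : ℝ) : morseCoord α (logAmp α y) = y :=
  Function.rightInverse_invFun (surjective_morseCoord hα) y

lemma logAmp_morseCoord (hα : 1 < α) (v : ℝ) : logAmp α (morseCoord α v) = v :=
  Function.leftInverse_invFun (strictMono_morseCoord hα).injective v

lemma normPotential_logAmp (hα : 1 < α) (y : ℝ) : normPotential α (logAmp α y) = 1 + y ^ 2 := by
  have := morseCoord_sq hα (logAmp α y)
  rw [morseCoord_logAmp hα] at this
  linarith

lemma logAmp_zero (hα : 1 < α) : logAmp α 0 = 0 := by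
  simpa using logAmp_morseCoord hα 0

lemma strictMono_logAmp (hα : 1 < α) : StrictMono (logAmp α) := fun x y hxy => by
  rwa [← (strictMono_morseCoord hα).lt_iff_lt, morseCoord_logAmp hα, morseCoord_logAmp hα]

lemma continuous_logAmp (hα : 1 < α) : Continuous (logAmp α) :=
  (strictMono_logAmp hα).monotone.continuous_of_surjective
    fun v => ⟨morseCoord α v, logAmp_morseCoord hα v⟩

lemma amp_pos (α y : ℝ) : 0 < amp α y := exp_pos _

lemma strictMono_amp (hα : 1 < α) : StrictMono (amp α) :=
  exp_strictMono.comp (strictMono_logAmp hα)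

lemma continuous_amp (hα : 1 < α) : Continuous (amp α) :=
  continuous_exp.comp (continuous_logAmp hα)

lemma ampDeriv_pos (hα : 1 < α) (y : ℝ) : 0 < ampDeriv α y :=
  div_pos (amp_pos α y) (morseCoordDeriv_pos hα _)

lemma continuous_ampDeriv (hα : 1 < α) : Continuous (ampDeriv α) :=
  (continuous_amp hα).div ((continuous_morseCoordDeriv hα).comp (continuous_logAmp hα))
    fun _ => (morseCoordDeriv_pos hα _).ne'

lemma ampDeriv_zero (hα : 1 < α) : ampDeriv α 0 = 1 / √(2 * α) := by
  simp [ampDeriv, amp, morseCoordDeriv, logAmp_zero hα]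

lemma hasDerivAt_amp (hα : 1 < α) (y : ℝ) : HasDerivAt (amp α) (ampDeriv α y) y :=
  (HasDerivAt.of_local_left_inverse (continuous_logAmp hα).continuousAt
    (hasDerivAt_morseCoord hα _) (morseCoordDeriv_pos hα _).ne'
    (.of_forall (morseCoord_logAmp hα))).exp

lemma exists_pos_mul_rpow_le_ampDeriv (hα : 1 < α) :
    ∃ c : ℝ, 0 < c ∧ ∀ y : ℝ, 0 ≤ y →
      c * (1 + y ^ 2) ^ (-((α - 1) / (2 * α))) ≤ ampDeriv α y := by
  have hs : -((α - 1) / (2 * α)) ≤ 0 := neg_nonpos.2 (div_nonneg (by linarith) (by linarith))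
  obtain ⟨y₀, -, hy₀⟩ := isCompact_Icc.exists_isMinOn (nonempty_Icc.2 (zero_le_one' ℝ))
    (continuous_ampDeriv hα).continuousOn
  set r : ℝ := (2 * α - 1) / (2 * α) with hr
  set c : ℝ := (1 + α) / (α * √2) * (1 + α) ^ (-r) with hc
  have hcpos : 0 < c := by positivity
  refine ⟨min (ampDeriv α y₀) c, lt_min (ampDeriv_pos hα _) hcpos, fun y hy => ?_⟩
  have hP : 0 < 1 + y ^ 2 := by positivity
  rcases le_or_gt y 1 with hy1 | hy1
  · calc _ ≤ ampDeriv α y₀ * 1 := by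
          refine mul_le_mul (min_le_left _ _) ?_ (by positivity) (ampDeriv_pos hα _).le
          exact rpow_le_one_of_one_le_of_nonpos (by nlinarith) hs
      _ ≤ ampDeriv α y := by simpa using hy₀ ⟨hy, hy1⟩
  · set v := logAmp α y with hv
    have hv0 : 0 < v := by
      rw [hv, ← logAmp_zero hα]
      exact strictMono_logAmp hα (by linarith)
    have hderiv : ampDeriv α y = exp v * (2 * y) / normPotentialDeriv α v := by
      rw [ampDeriv, amp, ← hv, morseCoordDeriv, if_neg hv0.ne', hv, morseCoord_logAmp hα,
        div_div_eq_mul_div]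
    have hpd : normPotentialDeriv α v ≤ 2 * α / (1 + α) * exp (2 * α * v) := by
      rw [normPotentialDeriv]
      gcongr
      linarith [exp_pos (-2 * v)]
    have hexp : exp (2 * α * v) ≤ (1 + α) * (1 + y ^ 2) := by
      have h := normPotential_logAmp hα y
      rw [← hv, normPotential, div_eq_iff (by positivity)] at h
      nlinarith [exp_pos (-2 * v)]
    have hpow : ((1 + α) * (1 + y ^ 2)) ^ (-r) ≤ exp v / exp (2 * α * v) := by
      have : exp v / exp (2 * α * v) = exp (2 * α * v) ^ (-r) := by
        rw [← exp_sub, ← exp_mul, hr]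
        congr 1
        field_simp
        ring
      rw [this]
      exact rpow_le_rpow_of_nonpos (exp_pos _) hexp
        (neg_nonpos.2 (div_nonneg (by linarith) (by linarith)))
    have hsq : (1 + y ^ 2) ^ (1 / 2 : ℝ) / √2 ≤ y := by
      rw [← sqrt_eq_rpow, ← sqrt_div hP.le]
      exact (sqrt_le_left hy).2 (by nlinarith)
    have hexpo : (1 + y ^ 2) ^ (-((α - 1) / (2 * α))) =
        (1 + y ^ 2) ^ (1 / 2 : ℝ) * (1 + y ^ 2) ^ (-r) := by
      rw [← rpow_add hP, hr]
      congr 1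
      field_simp
      ring
    calc _ ≤ c * (1 + y ^ 2) ^ (-((α - 1) / (2 * α))) := by
          gcongr
          exact min_le_right _ _
      _ = (1 + α) / α * ((1 + y ^ 2) ^ (1 / 2 : ℝ) / √2) * ((1 + α) * (1 + y ^ 2)) ^ (-r) := by
          rw [hexpo, hc, mul_rpow (by positivity) hP.le]
          field_simp
      _ ≤ (1 + α) / α * y * (exp v / exp (2 * α * v)) := by gcongr
      _ = exp v * (2 * y) / (2 * α / (1 + α) * exp (2 * α * v)) := by field_simp
      _ ≤ ampDeriv α y := by
          rw [hderiv]
          have := normPotentialDeriv_pos hα hv0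
          gcongr

end Morse

section SineAverage

variable {U g : ℝ → ℝ}

lemma integral_sin_mul_comp_sin (hU : ∀ y, HasDerivAt U (g y) y) (hg : Continuous g) (Y : ℝ) :
    ∫ θ in -(π / 2)..π / 2, sin θ * U (Y * sin θ) =
      Y * ∫ θ in -(π / 2)..π / 2, cos θ ^ 2 * g (Y * sin θ) := by
  have hd : ∀ θ : ℝ, HasDerivAt (fun θ => U (Y * sin θ)) (g (Y * sin θ) * (Y * cos θ)) θ :=
    fun θ => (hU _).comp θ ((hasDerivAt_sin θ).const_mul Y)
  have h := intervalIntegral.integral_mul_deriv_eq_deriv_mul (a := -(π / 2)) (b := π / 2)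
    (fun θ _ => hd θ) (fun θ _ => (hasDerivAt_cos θ))
    (Continuous.intervalIntegrable (by fun_prop) _ _)
    (Continuous.intervalIntegrable (by fun_prop) _ _)
  simp only [mul_neg, intervalIntegral.integral_neg, cos_neg, cos_pi_div_two, mul_zero,
    sub_self, zero_sub, neg_inj] at h
  rw [← intervalIntegral.integral_const_mul]
  simp_rw [mul_comm (sin _)]
  rw [h]
  congr 1 with θ
  ring

lemma hasDerivAt_integral_sin_mul_comp_sin (hU : ∀ y, HasDerivAt U (g y) y)
    (hg : Continuous g) (Y : ℝ) :
    HasDerivAt (fun Y => ∫ θ in -(π / 2)..π / 2, sin θ * U (Y * sin θ))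
      (∫ θ in -(π / 2)..π / 2, sin θ ^ 2 * g (Y * sin θ)) Y := by
  have hUc : Continuous U := continuous_iff_continuousAt.2 fun y => (hU y).continuousAt
  obtain ⟨M, hM⟩ := (isCompact_closedBall (0 : ℝ) (|Y| + 1)).exists_bound_of_continuousOn
    hg.continuousOn
  refine (intervalIntegral.hasDerivAt_integral_of_dominated_loc_of_deriv_le
    (F' := fun Y θ => sin θ ^ 2 * g (Y * sin θ)) (bound := fun _ => M)
    (Metric.ball_mem_nhds Y one_pos) ?_ ?_ ?_ ?_ ?_ ?_).2
  · exact .of_forall fun _ => Continuous.aestronglyMeasurable (by fun_prop)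
  · exact Continuous.intervalIntegrable (by fun_prop) _ _
  · exact Continuous.aestronglyMeasurable (by fun_prop)
  · refine .of_forall fun θ _ Z hZ => ?_
    have hZ' : |Z| ≤ |Y| + 1 := by
      have h1 := abs_sub_abs_le_abs_sub Z Y
      rw [Metric.mem_ball, dist_eq] at hZ
      linarith
    have hmem : Z * sin θ ∈ Metric.closedBall (0 : ℝ) (|Y| + 1) := by
      rw [mem_closedBall_zero_iff, norm_eq_abs, abs_mul]
      calc _ ≤ |Z| * 1 := by gcongr; exact abs_sin_le_one θ
        _ ≤ _ := by linarith
    rw [norm_mul, norm_eq_abs (sin θ ^ 2), abs_of_nonneg (sq_nonneg _)]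
    calc _ ≤ 1 * ‖g (Z * sin θ)‖ := by gcongr; exact sin_sq_le_one θ
      _ ≤ M := by simpa using hM _ hmem
  · exact Continuous.intervalIntegrable (by fun_prop) _ _
  · refine .of_forall fun θ _ Z _ => ?_
    refine (((hU (Z * sin θ)).comp Z ((hasDerivAt_id Z).mul_const (sin θ))).const_mul
      (sin θ)).congr_deriv ?_
    ring

lemma hasDerivAt_mul_integral_sin_mul_comp_sin (hU : ∀ y, HasDerivAt U (g y) y)
    (hg : Continuous g) (Y : ℝ) :
    HasDerivAt (fun Y => Y * ∫ θ in -(π / 2)..π / 2, sin θ * U (Y * sin θ))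
      (Y * ∫ θ in -(π / 2)..π / 2, g (Y * sin θ)) Y := by
  refine ((hasDerivAt_id Y).mul (hasDerivAt_integral_sin_mul_comp_sin hU hg Y)).congr_deriv ?_
  rw [integral_sin_mul_comp_sin hU hg, id, one_mul, ← mul_add,
    ← intervalIntegral.integral_add (Continuous.intervalIntegrable (by fun_prop) _ _)
      (Continuous.intervalIntegrable (by fun_prop) _ _)]
  congr 2 with θ
  rw [← add_mul, cos_sq_add_sin_sq, one_mul]

end SineAverage

/-- The positive `u` at which the double root of `Vfun α (rhoC α)` sits. -/
def criticalPoint (α : ℝ) : ℝ := α ^ (-(1 / (2 * α + 2)))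

/-- `∫ g (Y * sin θ) dθ` over `[-π/2, π/2]`, with `g` the derivative of `amp`. -/
def ampDerivAverage (α Y : ℝ) : ℝ := ∫ θ in -(π / 2)..π / 2, ampDeriv α (Y * sin θ)

/-- A closed form of `π * Sfun`, up to a constant factor, in the variable `Y = √(ξ - 1)`. -/
def wkbProfile (α Y : ℝ) : ℝ := Y * ∫ θ in -(π / 2)..π / 2, sin θ * amp α (Y * sin θ)

section WKB

variable {α : ℝ}

lemma criticalPoint_pos (hα : 1 < α) : 0 < criticalPoint α := rpow_pos_of_pos (by linarith) _

lemma rhoC_pos (hα : 1 < α) : 0 < rhoC α := by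
  have : 0 < α ^ (1 / (α + 1)) := rpow_pos_of_pos (by linarith) _
  rw [rhoC]
  positivity

lemma criticalPoint_rpow (hα : 1 < α) : criticalPoint α ^ (2 * α + 2) = 1 / α := by
  have h : -(1 / (2 * α + 2)) * (2 * α + 2) = -1 := by field_simp
  rw [criticalPoint, ← rpow_mul (by linarith), h, rpow_neg_one, one_div]

lemma rhoC_mul_criticalPoint_sq (hα : 1 < α) :
    rhoC α * criticalPoint α ^ 2 = (1 + α) / α := by
  have h : α ^ (1 / (α + 1)) * criticalPoint α ^ 2 = 1 := by
    rw [criticalPoint, ← rpow_natCast, ← rpow_mul (by linarith), ← rpow_add (by linarith)]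
    convert rpow_zero α using 2
    push_cast
    field_simp
    ring
  rw [rhoC, mul_assoc, h, mul_one, add_comm]

lemma Vfun_criticalPoint_mul_exp (hα : 1 < α) (ξ v : ℝ) :
    Vfun α (rhoC α * ξ) (criticalPoint α * exp v) =
      (1 + α) / α * exp v ^ 2 * (ξ - normPotential α v) := by
  have h1 : exp v ^ (2 * α + 2) = exp v ^ 2 * exp (2 * α * v) := by
    rw [← exp_mul, ← exp_nat_mul, ← exp_add]
    congr 1
    push_cast
    ring
  have h2 : exp v ^ 2 * exp (-2 * v) = 1 := by
    rw [← exp_nat_mul, ← exp_add]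
    convert exp_zero using 2
    push_cast
    ring
  have h3 := rhoC_mul_criticalPoint_sq hα
  rw [Vfun, mul_rpow (criticalPoint_pos hα).le (exp_pos v).le, criticalPoint_rpow hα, h1,
    normPotential]
  calc _ = rhoC α * criticalPoint α ^ 2 * ξ * exp v ^ 2
        - 1 / α * (exp v ^ 2 * exp (2 * α * v)) - exp v ^ 2 * exp (-2 * v) := by rw [h2]; ring
    _ = _ := by rw [h3]; field_simp; ring

lemma setOf_pos_Vfun_eq_zero (hα : 1 < α) (Y : ℝ) :
    {u : ℝ | 0 < u ∧ Vfun α (rhoC α * (1 + Y ^ 2)) u = 0} =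
      {criticalPoint α * amp α (-Y), criticalPoint α * amp α Y} := by
  have hc := criticalPoint_pos hα
  have hroot : ∀ y : ℝ, y ^ 2 = Y ^ 2 →
      Vfun α (rhoC α * (1 + Y ^ 2)) (criticalPoint α * amp α y) = 0 := fun y hy => by
    rw [amp, Vfun_criticalPoint_mul_exp hα, normPotential_logAmp hα, hy, sub_self, mul_zero]
  ext u
  simp only [mem_ofPred_eq, mem_insert_iff, mem_singleton_iff]
  constructor
  · rintro ⟨hu, hV⟩
    obtain ⟨v, rfl⟩ : ∃ v, u = criticalPoint α * exp v :=
      ⟨log (u / criticalPoint α), by rw [exp_log (by positivity)]; field_simp⟩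
    have hne : (1 + α) / α * exp v ^ 2 ≠ 0 := by positivity
    rw [Vfun_criticalPoint_mul_exp hα, mul_eq_zero, or_iff_right hne] at hV
    have hsq : morseCoord α v ^ 2 = Y ^ 2 := by
      rw [morseCoord_sq hα]
      linarith
    rw [amp, amp, ← logAmp_morseCoord hα v]
    rcases sq_eq_sq_iff_eq_or_eq_neg.1 hsq with h | h
    · exact .inr (by rw [h])
    · exact .inl (by rw [h])
  · rintro (rfl | rfl)
    · exact ⟨mul_pos hc (amp_pos α _), hroot _ (neg_sq Y)⟩
    · exact ⟨mul_pos hc (amp_pos α _), hroot _ rfl⟩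

lemma u1F_eq (hα : 1 < α) {Y : ℝ} (hY : 0 ≤ Y) :
    u1F α (rhoC α * (1 + Y ^ 2)) = criticalPoint α * amp α (-Y) := by
  rw [u1F, setOf_pos_Vfun_eq_zero hα, csInf_pair, inf_eq_left]
  exact mul_le_mul_of_nonneg_left ((strictMono_amp hα).monotone (by linarith))
    (criticalPoint_pos hα).le

lemma u2F_eq (hα : 1 < α) {Y : ℝ} (hY : 0 ≤ Y) :
    u2F α (rhoC α * (1 + Y ^ 2)) = criticalPoint α * amp α Y := by
  rw [u2F, setOf_pos_Vfun_eq_zero hα, csSup_pair, sup_eq_right]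
  exact mul_le_mul_of_nonneg_left ((strictMono_amp hα).monotone (by linarith))
    (criticalPoint_pos hα).le

lemma continuous_Vfun (hα : 1 < α) (x : ℝ) : Continuous (Vfun α x) := by
  have : Continuous fun u : ℝ => u ^ (2 * α + 2) := continuous_rpow_const (by linarith)
  unfold Vfun
  fun_prop

lemma integral_sqrt_Vfun_div (hα : 1 < α) {Y : ℝ} (hY : 0 ≤ Y) :
    ∫ u in u1F α (rhoC α * (1 + Y ^ 2))..u2F α (rhoC α * (1 + Y ^ 2)),
      √(Vfun α (rhoC α * (1 + Y ^ 2)) u) / u = √((1 + α) / α) * wkbProfile α Y := by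
  have hc := criticalPoint_pos hα
  have hgc := continuous_ampDeriv hα
  set f : ℝ → ℝ := fun θ => criticalPoint α * amp α (Y * sin θ) with hf
  set f' : ℝ → ℝ := fun θ => criticalPoint α * (ampDeriv α (Y * sin θ) * (Y * cos θ)) with hf'
  have hfpos : ∀ θ, 0 < f θ := fun θ => mul_pos hc (amp_pos _ _)
  have hd : ∀ θ, HasDerivAt f (f' θ) θ := fun θ =>
    ((hasDerivAt_amp hα _).comp θ ((hasDerivAt_sin θ).const_mul Y)).const_mul _
  have hcont : ContinuousOn (fun u => √(Vfun α (rhoC α * (1 + Y ^ 2)) u) / u)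
      (f '' uIcc (-(π / 2)) (π / 2)) := by
    refine (continuous_Vfun hα _).sqrt.continuousOn.div continuousOn_id ?_
    rintro _ ⟨θ, -, rfl⟩
    exact (hfpos θ).ne'
  have hsub := intervalIntegral.integral_comp_mul_deriv' (fun θ _ => hd θ)
    (Continuous.continuousOn (by fun_prop)) hcont
  have hleft : f (-(π / 2)) = u1F α (rhoC α * (1 + Y ^ 2)) := by
    simp [hf, u1F_eq hα hY]
  have hright : f (π / 2) = u2F α (rhoC α * (1 + Y ^ 2)) := by
    simp [hf, u2F_eq hα hY]
  rw [hleft, hright] at hsub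
  rw [← hsub, wkbProfile, integral_sin_mul_comp_sin (hasDerivAt_amp hα) hgc,
    ← intervalIntegral.integral_const_mul, ← intervalIntegral.integral_const_mul,
    ← intervalIntegral.integral_const_mul]
  refine intervalIntegral.integral_congr fun θ hθ => ?_
  rw [uIcc_of_le (by linarith [pi_pos])] at hθ
  have hcos : 0 ≤ cos θ := cos_nonneg_of_mem_Icc hθ
  have hV : √(Vfun α (rhoC α * (1 + Y ^ 2)) (f θ)) =
      √((1 + α) / α) * (amp α (Y * sin θ) * (Y * cos θ)) := by
    have h : (1 + α) / α * amp α (Y * sin θ) ^ 2 * (1 + Y ^ 2 - (1 + (Y * sin θ) ^ 2)) =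
        (1 + α) / α * (amp α (Y * sin θ) * (Y * cos θ)) ^ 2 := by
      linear_combination -((1 + α) / α * amp α (Y * sin θ) ^ 2 * Y ^ 2) * sin_sq_add_cos_sq θ
    have hnn : 0 ≤ amp α (Y * sin θ) * (Y * cos θ) :=
      mul_nonneg (amp_pos _ _).le (mul_nonneg hY hcos)
    change √(Vfun α (rhoC α * (1 + Y ^ 2)) (criticalPoint α * exp (logAmp α (Y * sin θ)))) = _
    rw [Vfun_criticalPoint_mul_exp hα, normPotential_logAmp hα, ← amp, h,
      sqrt_mul (by positivity), sqrt_sq hnn]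
  have hamp := amp_pos α (Y * sin θ)
  simp only [Function.comp_apply]
  rw [hV]
  simp only [hf, hf']
  field_simp

lemma tauF_eq (hα : 1 < α) {ξ : ℝ} (hξ : 1 ≤ ξ) :
    tauF α ξ = 2 * (1 + α) * √((1 + α) / α) / π * wkbProfile α √(ξ - 1) := by
  rcases hξ.eq_or_lt with rfl | hξ
  · simp [tauF, Sfun, wkbProfile]
  · have h := integral_sqrt_Vfun_div hα (sqrt_nonneg (ξ - 1))
    rw [sq_sqrt (by linarith), add_sub_cancel] at h
    rw [tauF, Sfun, if_pos (lt_mul_of_one_lt_right (rhoC_pos hα) hξ), h]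
    ring

lemma hasDerivAt_wkbProfile (hα : 1 < α) (Y : ℝ) :
    HasDerivAt (wkbProfile α) (Y * ampDerivAverage α Y) Y :=
  hasDerivAt_mul_integral_sin_mul_comp_sin (hasDerivAt_amp hα) (continuous_ampDeriv hα) Y

lemma continuous_wkbProfile (hα : 1 < α) : Continuous (wkbProfile α) :=
  continuous_iff_continuousAt.2 fun Y => (hasDerivAt_wkbProfile hα Y).continuousAt

lemma continuous_ampDerivAverage (hα : 1 < α) : Continuous (ampDerivAverage α) := by
  have := continuous_ampDeriv hα
  exact intervalIntegral.continuous_parametric_intervalIntegral_of_continuous' (by fun_prop) _ _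

lemma ampDerivAverage_zero (hα : 1 < α) : ampDerivAverage α 0 = π / √(2 * α) := by
  simp only [ampDerivAverage, zero_mul, ampDeriv_zero hα, intervalIntegral.integral_const,
    smul_eq_mul]
  ring

lemma ampDerivAverage_pos (hα : 1 < α) (Y : ℝ) : 0 < ampDerivAverage α Y := by
  have := continuous_ampDeriv hα
  exact intervalIntegral.intervalIntegral_pos_of_pos
    (Continuous.intervalIntegrable (by fun_prop) _ _) (fun θ => ampDeriv_pos hα _)
    (by linarith [pi_pos])

lemma exists_pos_mul_rpow_le_ampDerivAverage (hα : 1 < α) :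
    ∃ c : ℝ, 0 < c ∧ ∀ Y : ℝ, 0 ≤ Y →
      c * (1 + Y ^ 2) ^ (-((α - 1) / (2 * α))) ≤ ampDerivAverage α Y := by
  obtain ⟨c, hc, h⟩ := exists_pos_mul_rpow_le_ampDeriv hα
  have hs : -((α - 1) / (2 * α)) ≤ 0 := neg_nonpos.2 (div_nonneg (by linarith) (by linarith))
  have hg := continuous_ampDeriv hα
  have hint : ∀ Y a b : ℝ, IntervalIntegrable (fun θ => ampDeriv α (Y * sin θ)) volume a b :=
    fun Y a b => Continuous.intervalIntegrable (by fun_prop) _ _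
  refine ⟨π / 2 * c, by positivity, fun Y hY => ?_⟩
  have hneg : 0 ≤ ∫ θ in -(π / 2)..0, ampDeriv α (Y * sin θ) :=
    intervalIntegral.integral_nonneg (by linarith [pi_pos]) fun θ _ => (ampDeriv_pos hα _).le
  have hpos : ∫ _ in (0 : ℝ)..π / 2, c * (1 + Y ^ 2) ^ (-((α - 1) / (2 * α))) ≤
      ∫ θ in 0..π / 2, ampDeriv α (Y * sin θ) := by
    refine intervalIntegral.integral_mono_on (by positivity) intervalIntegrable_const
      (hint _ _ _) fun θ hθ => ?_
    have hsin : 0 ≤ sin θ := sin_nonneg_of_mem_Icc ⟨hθ.1, by linarith [hθ.2, pi_pos]⟩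
    refine le_trans ?_ (h (Y * sin θ) (mul_nonneg hY hsin))
    refine mul_le_mul_of_nonneg_left (rpow_le_rpow_of_nonpos (by positivity) ?_ hs) hc.le
    rw [mul_pow]
    nlinarith [sin_sq_le_one θ, sq_nonneg Y]
  rw [ampDerivAverage, ← intervalIntegral.integral_add_adjacent_intervals (hint _ _ 0) (hint _ _ _)]
  rw [intervalIntegral.integral_const, smul_eq_mul] at hpos
  linarith

lemma hasDerivAt_tauF (hα : 1 < α) {ξ : ℝ} (hξ : 1 < ξ) :
    HasDerivAt (tauF α) ((1 + α) * √((1 + α) / α) / π * ampDerivAverage α √(ξ - 1)) ξ := by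
  have hY : 0 < √(ξ - 1) := sqrt_pos.2 (by linarith)
  have hs : HasDerivAt (fun ξ => √(ξ - 1)) (1 / (2 * √(ξ - 1))) ξ :=
    ((hasDerivAt_id ξ).sub_const 1).sqrt (by simpa using (sub_pos.2 hξ).ne')
  have h := ((hasDerivAt_wkbProfile hα _).comp ξ hs).const_mul
    (2 * (1 + α) * √((1 + α) / α) / π)
  refine (h.congr_of_eventuallyEq ?_).congr_deriv ?_
  · filter_upwards [Ioi_mem_nhds hξ] with η hη
    exact tauF_eq hα (le_of_lt hη)
  · field_simp

lemma continuousOn_tauF (hα : 1 < α) : ContinuousOn (tauF α) (Ici 1) := by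
  have := continuous_wkbProfile hα
  have h : Continuous fun ξ =>
    2 * (1 + α) * √((1 + α) / α) / π * wkbProfile α √(ξ - 1) := by fun_prop
  exact h.continuousOn.congr fun ξ hξ => tauF_eq hα hξ

lemma tendsto_deriv_tauF (hα : 1 < α) :
    Tendsto (deriv (tauF α)) (𝓝[>] 1)
      (𝓝 ((1 + α) * √((1 + α) / α) / π * ampDerivAverage α √(1 - 1))) := by
  have := continuous_ampDerivAverage hα
  have h : Continuous fun ξ : ℝ =>
    (1 + α) * √((1 + α) / α) / π * ampDerivAverage α √(ξ - 1) := by fun_prop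
  refine (tendsto_nhdsWithin_of_tendsto_nhds (h.tendsto 1)).congr' ?_
  filter_upwards [self_mem_nhdsWithin] with ξ hξ
  exact (hasDerivAt_tauF hα hξ).deriv.symm

lemma derivWithin_tauF (hα : 1 < α) {ξ : ℝ} (hξ : 1 ≤ ξ) :
    derivWithin (tauF α) (Ici 1) ξ =
      (1 + α) * √((1 + α) / α) / π * ampDerivAverage α √(ξ - 1) := by
  refine HasDerivWithinAt.derivWithin ?_ (uniqueDiffOn_Ici 1 ξ hξ)
  rcases hξ.eq_or_lt with rfl | hξ
  · exact hasDerivWithinAt_Ici_of_tendsto_deriv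
      (fun ξ hξ => (hasDerivAt_tauF hα hξ).differentiableAt.differentiableWithinAt)
      ((continuousOn_tauF hα 1 self_mem_Ici).mono Ioi_subset_Ici_self) self_mem_nhdsWithin
      (tendsto_deriv_tauF hα)
  · exact (hasDerivAt_tauF hα hξ).hasDerivWithinAt

end WKB

theorem statement8 (α : ℝ) (hα : 1 < α) :
    -- lim_{ξ→1⁺} τ′(ξ) = (1+α)^{3/2}/(√2·α)
    Tendsto (deriv (tauF α)) (𝓝[>] (1:ℝ))
      (𝓝 ((1 + α) ^ ((3:ℝ)/2) / (Real.sqrt 2 * α))) ∧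
    -- τ is strictly increasing on [1,∞)
    StrictMonoOn (tauF α) (Set.Ici 1) ∧
    -- inf_{ξ≥1} ξ^{−(1+α)/(2α)} Dτ(ξ) > 0
    (∃ c : ℝ, 0 < c ∧ ∀ ξ : ℝ, 1 ≤ ξ →
      c ≤ ξ ^ (-((1 + α) / (2 * α))) * eulerDW (Set.Ici 1) (tauF α) ξ) := by
  have hconst : 0 < (1 + α) * √((1 + α) / α) / π := by positivity
  refine ⟨?_, ?_, ?_⟩
  · convert tendsto_deriv_tauF hα using 2
    have h : (1 + α) ^ ((3 : ℝ) / 2) = (1 + α) * √(1 + α) := by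
      rw [sqrt_eq_rpow, ← rpow_one_add' (by positivity) (by norm_num)]
      norm_num
    rw [sub_self, sqrt_zero, ampDerivAverage_zero hα, h, sqrt_div (by positivity),
      sqrt_mul zero_le_two]
    field_simp
    rw [sq_sqrt (by positivity)]
  · refine strictMonoOn_of_deriv_pos (convex_Ici 1) (continuousOn_tauF hα) fun ξ hξ => ?_
    rw [interior_Ici] at hξ
    rw [(hasDerivAt_tauF hα hξ).deriv]
    exact mul_pos hconst (ampDerivAverage_pos hα _)
  · obtain ⟨c, hc, h⟩ := exists_pos_mul_rpow_le_ampDerivAverage hα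
    refine ⟨(1 + α) * √((1 + α) / α) / π * c, mul_pos hconst hc, fun ξ hξ => ?_⟩
    have hξ0 : 0 < ξ := by linarith
    have hJ := h _ (sqrt_nonneg (ξ - 1))
    rw [sq_sqrt (by linarith), add_sub_cancel] at hJ
    have hpow : ξ ^ (-((1 + α) / (2 * α))) * ξ * ξ ^ (-((α - 1) / (2 * α))) = 1 := by
      rw [← rpow_add_one hξ0.ne', ← rpow_add hξ0]
      convert rpow_zero ξ using 2
      field_simp
      ring
    rw [eulerDW, derivWithin_tauF hα hξ]
    calc _ = ξ ^ (-((1 + α) / (2 * α))) * (ξ * ((1 + α) * √((1 + α) / α) / π *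
            (c * ξ ^ (-((α - 1) / (2 * α)))))) := by
          linear_combination -((1 + α) * √((1 + α) / α) / π * c) * hpow
      _ ≤ _ := by gcongr
end
end

section
/- Let α > 1 and n ∈ ℕ, and let K_α(x;n) = Dⁿ K_α(x) be the n-th Euler derivative of the kernel K_α. Then: (i) K_α(·;n) is a rational function, smooth on (0,∞), vanishing linearly at x = 0 and at x = ∞; (ii) K_α(x/y; n) = (−1)ⁿ K_α(y/x; n) for all x, y > 0; (iii) there exists C_n > 0 (depending only on α and n) such that sup_{x>0}|K_α(x;n)| ≤ C_n, sup_{y>0}|K_α(x/y;n)/y| ≤ C_n/x for all x > 0, sup_{y>0}|∂_y[K_α(x/y;n)/y]| ≤ C_n/x² for all x > 0, and sup_{x>0}|∂_y[K_α(x/y;n)/y]| ≤ C_n/y² for all y > 0. -/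
open Real MeasureTheory Set Filter Topology Asymptotics

noncomputable section

/-- The kernel `K_α`. -/
def Ka (α x : ℝ) : ℝ :=
  (Real.sin (2 * π / (1 + α)) / π) *
    (x / (1 + x ^ 2 - 2 * x * Real.cos (2 * π / (1 + α))))

/-- The Euler operator D = x d/dx. -/
def eulerD (f : ℝ → ℝ) : ℝ → ℝ := fun x => x * deriv f x

/-- K_α(x;n) = Dⁿ K_α(x). -/
def Kan (α : ℝ) (n : ℕ) : ℝ → ℝ := (eulerD)^[n] (Ka α)

theorem sin_two_pi_div_pos {α : ℝ} (hα : 1 < α) : 0 < Real.sin (2 * π / (1 + α)) := by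
  refine Real.sin_pos_of_pos_of_lt_pi (by positivity) ?_
  rw [div_lt_iff₀ (by linarith)]
  nlinarith [pi_pos]

theorem Kan_succ (α : ℝ) (n : ℕ) (x : ℝ) : Kan α (n + 1) x = x * deriv (Kan α n) x := by
  rw [Kan, Function.iterate_succ_apply']
  rfl

open Polynomial in
/-- `Kan α n` is `x` times a rational function without real poles whose value at `0` is
the leading coefficient `sin (2π/(1+α)) / π`. -/
theorem exists_Kan_eq_mul_div {α : ℝ} (hα : 1 < α) (n : ℕ) :
    ∃ P Q : Polynomial ℝ, (∀ x, Q.eval x ≠ 0) ∧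
      P.eval 0 / Q.eval 0 = Real.sin (2 * π / (1 + α)) / π ∧
      ∀ x, Kan α n x = x * (P.eval x / Q.eval x) := by
  induction n with
  | zero =>
    refine ⟨C (Real.sin (2 * π / (1 + α)) / π),
      1 + X ^ 2 - C (2 * Real.cos (2 * π / (1 + α))) * X, fun x => ?_, by simp, fun x => ?_⟩
    · have hs := sin_two_pi_div_pos hα
      have hsc := Real.sin_sq_add_cos_sq (2 * π / (1 + α))
      simp only [eval_sub, eval_add, eval_one, eval_pow, eval_X, eval_mul, eval_C]
      nlinarith [sq_nonneg (x - Real.cos (2 * π / (1 + α))), mul_pos hs hs]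
    · simp only [Kan, Function.iterate_zero, id, Ka, eval_sub, eval_add, eval_one, eval_pow,
        eval_X, eval_mul, eval_C]
      ring
  | succ n ih =>
    obtain ⟨P, Q, hQ, h0, h⟩ := ih
    refine ⟨P * Q + X * (derivative P * Q - P * derivative Q), Q ^ 2, fun x => ?_, ?_,
      fun x => ?_⟩
    · simpa using hQ x
    · rw [← h0]
      have := hQ 0
      simp only [eval_add, eval_mul, eval_X, eval_pow]
      field_simp
      ring
    · have hd := (hasDerivAt_id x).mul ((P.hasDerivAt x).div (Q.hasDerivAt x) (hQ x))
      replace hd := hd.congr_of_eventuallyEq (f₁ := Kan α n) (.of_forall h)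
      have := hQ x
      rw [Kan_succ, hd.deriv]
      simp only [eval_add, eval_mul, eval_X, eval_pow, eval_sub, id, Pi.div_apply]
      field_simp

theorem Polynomial.contDiff_eval_div_eval {P Q : Polynomial ℝ} (hQ : ∀ x, Q.eval x ≠ 0)
    {m : WithTop ℕ∞} : ContDiff ℝ m fun x => P.eval x / Q.eval x := by
  have hc (R : Polynomial ℝ) : ContDiff ℝ m fun x => R.eval x := by
    simpa using R.contDiff_aeval (𝕜 := ℝ) m
  exact (hc P).div (hc Q) hQ

/-- `Kan α n x = x * g x` with `g` smooth on the whole line and `g 0 ≠ 0`. -/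
theorem exists_Kan_eq_mul {α : ℝ} (hα : 1 < α) (n : ℕ) :
    ∃ g : ℝ → ℝ, ContDiff ℝ (⊤ : ℕ∞) g ∧ g 0 ≠ 0 ∧ ∀ x, Kan α n x = x * g x := by
  obtain ⟨P, Q, hQ, h0, h⟩ := exists_Kan_eq_mul_div hα n
  refine ⟨_, Polynomial.contDiff_eval_div_eval hQ, ?_, h⟩
  rw [h0]
  exact (div_pos (sin_two_pi_div_pos hα) pi_pos).ne'

theorem contDiff_Kan {α : ℝ} (hα : 1 < α) (n : ℕ) : ContDiff ℝ (⊤ : ℕ∞) (Kan α n) := by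
  obtain ⟨g, hg, -, h⟩ := exists_Kan_eq_mul hα n
  rw [funext h]
  exact contDiff_id.mul hg

theorem differentiable_Kan {α : ℝ} (hα : 1 < α) (n : ℕ) : Differentiable ℝ (Kan α n) :=
  (contDiff_Kan hα n).differentiable (by simp)

theorem Kan_inv {α : ℝ} (hα : 1 < α) (n : ℕ) (x : ℝ) :
    Kan α n x⁻¹ = (-1) ^ n * Kan α n x := by
  induction n generalizing x with
  | zero =>
    rcases eq_or_ne x 0 with rfl | hx
    · simp
    simp only [Kan, Function.iterate_zero, id, Ka, pow_zero, one_mul]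
    congr 1
    have : 1 + x⁻¹ ^ 2 - 2 * x⁻¹ * Real.cos (2 * π / (1 + α)) =
        (1 + x ^ 2 - 2 * x * Real.cos (2 * π / (1 + α))) / x ^ 2 := by
      field_simp
      ring
    rw [this, div_div_eq_mul_div]
    congr 1
    field_simp
  | succ n ih =>
    rcases eq_or_ne x 0 with rfl | hx
    · simp [Kan_succ]
    have h1 := (differentiable_Kan hα n x⁻¹).hasDerivAt.comp x (hasDerivAt_inv hx)
    have h2 := (differentiable_Kan hα n x).hasDerivAt.const_mul ((-1 : ℝ) ^ n)
    have h3 := h1.unique (h2.congr_of_eventuallyEq (.of_forall ih))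
    rw [Kan_succ, Kan_succ, pow_succ]
    have h4 : x⁻¹ * deriv (Kan α n) x⁻¹ =
        -x * (deriv (Kan α n) x⁻¹ * -(x ^ 2)⁻¹) := by
      field_simp
    rw [h4, h3]
    ring

theorem abs_Kan_inv {α : ℝ} (hα : 1 < α) (n : ℕ) (x : ℝ) : |Kan α n x⁻¹| = |Kan α n x| := by
  rw [Kan_inv hα, abs_mul, abs_pow, abs_neg, abs_one, one_pow, one_mul]

theorem exists_abs_le_on_Icc {f : ℝ → ℝ} (hf : Continuous f) :
    ∃ C, ∀ x, 0 < x → x ≤ 1 → |f x| ≤ C := by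
  obtain ⟨C, hC⟩ := isCompact_Icc.exists_bound_of_continuousOn (s := Icc (0 : ℝ) 1) hf.continuousOn
  exact ⟨C, fun x h0 h1 => hC x ⟨h0.le, h1⟩⟩

theorem exists_abs_Kan_le {α : ℝ} (hα : 1 < α) (n : ℕ) :
    ∃ C, ∀ x, 0 < x → |Kan α n x| ≤ C := by
  obtain ⟨C, hC⟩ := exists_abs_le_on_Icc (contDiff_Kan hα n).continuous
  refine ⟨C, fun x hx => ?_⟩
  rcases le_total x 1 with h | h
  · exact hC x hx h
  · rw [← abs_Kan_inv hα]
    exact hC _ (inv_pos.2 hx) (inv_le_one_of_one_le₀ h)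

theorem exists_abs_mul_Kan_le {α : ℝ} (hα : 1 < α) (n : ℕ) :
    ∃ C, ∀ x, 0 < x → |x * Kan α n x| ≤ C := by
  obtain ⟨g, hg, -, h⟩ := exists_Kan_eq_mul hα n
  obtain ⟨A, hA⟩ := exists_abs_Kan_le hα n
  obtain ⟨B, hB⟩ := exists_abs_le_on_Icc hg.continuous
  refine ⟨max A B, fun x hx => ?_⟩
  rw [abs_mul, abs_of_pos hx]
  rcases le_total x 1 with h1 | h1
  · exact (mul_le_of_le_one_left (abs_nonneg _) h1).trans ((hA x hx).trans (le_max_left _ _))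
  · rw [← abs_Kan_inv hα, h, abs_mul, abs_of_pos (inv_pos.2 hx), mul_inv_cancel_left₀ hx.ne']
    exact (hB _ (inv_pos.2 hx) (inv_le_one_of_one_le₀ h1)).trans (le_max_right _ _)

/-- The leading terms of `Kan α n` and `Kan α (n + 1)` at infinity cancel. -/
theorem exists_abs_sq_mul_Kan_add_le {α : ℝ} (hα : 1 < α) (n : ℕ) :
    ∃ C, ∀ x, 0 < x → |x ^ 2 * (Kan α (n + 1) x + Kan α n x)| ≤ C := by
  obtain ⟨g, hg, -, h⟩ := exists_Kan_eq_mul hα n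
  obtain ⟨A, hA⟩ := exists_abs_Kan_le hα n
  obtain ⟨D, hD⟩ := exists_abs_Kan_le hα (n + 1)
  obtain ⟨B, hB⟩ := exists_abs_le_on_Icc (hg.continuous_deriv (by simp))
  refine ⟨max (D + A) B, fun x hx => ?_⟩
  rcases le_total x 1 with h1 | h1
  · refine le_trans ?_ (le_max_left _ _)
    rw [abs_mul, abs_of_pos (pow_pos hx 2)]
    exact (mul_le_of_le_one_left (abs_nonneg _) (pow_le_one₀ hx.le h1)).trans
      ((abs_add_le _ _).trans (add_le_add (hD x hx) (hA x hx)))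
  · refine le_trans (le_of_eq ?_) ((hB _ (inv_pos.2 hx) (inv_le_one_of_one_le₀ h1)).trans
      (le_max_right _ _))
    have hd : HasDerivAt (Kan α n) (1 * g x⁻¹ + x⁻¹ * deriv g x⁻¹) x⁻¹ := by
      rw [funext h]
      exact (hasDerivAt_id _).mul ((hg.differentiable (by simp)) _).hasDerivAt
    have e1 : Kan α (n + 1) x = (-1) ^ (n + 1) * Kan α (n + 1) x⁻¹ := by
      simpa using Kan_inv hα (n + 1) x⁻¹
    have e2 : Kan α n x = (-1) ^ n * Kan α n x⁻¹ := by simpa using Kan_inv hα n x⁻¹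
    have e3 : x ^ 2 * (Kan α (n + 1) x + Kan α n x) = (-1) ^ (n + 1) * deriv g x⁻¹ := by
      rw [e1, e2, Kan_succ, hd.deriv, h, pow_succ]
      field_simp
      ring
    rw [e3, abs_mul, abs_pow, abs_neg, abs_one, one_pow, one_mul]

theorem deriv_Kan_div_div {α : ℝ} (hα : 1 < α) (n : ℕ) (x : ℝ) {y : ℝ} (hy : y ≠ 0) :
    deriv (fun t => Kan α n (x / t) / t) y =
      -((Kan α (n + 1) (x / y) + Kan α n (x / y)) / y ^ 2) := by
  have h1 : HasDerivAt (fun t => x / t) (-(x / y ^ 2)) y := by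
    simpa [div_eq_mul_inv] using (hasDerivAt_inv hy).const_mul x
  have h2 := ((differentiable_Kan hα n (x / y)).hasDerivAt.comp y h1).div (hasDerivAt_id y) hy
  refine h2.deriv.trans ?_
  simp only [Kan_succ, Function.comp, id]
  field_simp
  ring

theorem statement12 (α : ℝ) (n : ℕ) (hα : 1 < α) :
    -- (i) K_α(·;n) is rational, smooth on (0,∞), vanishing linearly at 0 and ∞
    (∃ P Q : Polynomial ℝ, ∀ x : ℝ, 0 < x →
      Polynomial.eval x Q ≠ 0 ∧ Kan α n x = Polynomial.eval x P / Polynomial.eval x Q) ∧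
    ContDiffOn ℝ (⊤ : ℕ∞) (Kan α n) (Set.Ioi 0) ∧
    (∃ c : ℝ, c ≠ 0 ∧ Tendsto (fun x => Kan α n x / x) (𝓝[>] (0:ℝ)) (𝓝 c)) ∧
    (∃ c : ℝ, c ≠ 0 ∧ Tendsto (fun x => x * Kan α n x) atTop (𝓝 c)) ∧
    -- (ii) the symmetry K_α(x/y;n) = (−1)ⁿ K_α(y/x;n)
    (∀ x y : ℝ, 0 < x → 0 < y → Kan α n (x / y) = (-1 : ℝ) ^ n * Kan α n (y / x)) ∧
    -- (iii) the four uniform bounds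
    (∃ C : ℝ, 0 < C ∧
      (∀ x : ℝ, 0 < x → |Kan α n x| ≤ C) ∧
      (∀ x : ℝ, 0 < x → ∀ y : ℝ, 0 < y → |Kan α n (x / y) / y| ≤ C / x) ∧
      (∀ x : ℝ, 0 < x → ∀ y : ℝ, 0 < y →
        |deriv (fun t => Kan α n (x / t) / t) y| ≤ C / x ^ 2) ∧
      (∀ x : ℝ, 0 < x → ∀ y : ℝ, 0 < y →
        |deriv (fun t => Kan α n (x / t) / t) y| ≤ C / y ^ 2)) := by
  obtain ⟨g, hg, hg0, h⟩ := exists_Kan_eq_mul hα n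
  have hlim : Tendsto (fun x => Kan α n x / x) (𝓝[>] (0 : ℝ)) (𝓝 (g 0)) := by
    refine ((hg.continuous.tendsto 0).mono_left nhdsWithin_le_nhds).congr' ?_
    filter_upwards [self_mem_nhdsWithin] with x hx
    rw [h, mul_div_cancel_left₀ _ (ne_of_gt hx)]
  refine ⟨?_, (contDiff_Kan hα n).contDiffOn, ⟨g 0, hg0, hlim⟩,
    ⟨(-1) ^ n * g 0, by simp [hg0], ?_⟩, fun x y _ _ => ?_, ?_⟩
  · obtain ⟨P, Q, hQ, -, hPQ⟩ := exists_Kan_eq_mul_div hα n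
    refine ⟨Polynomial.X * P, Q, fun x _ => ⟨hQ x, ?_⟩⟩
    rw [hPQ, Polynomial.eval_mul, Polynomial.eval_X, mul_div_assoc]
  · refine ((hlim.comp tendsto_inv_atTop_nhdsGT_zero).const_mul ((-1 : ℝ) ^ n)).congr fun x => ?_
    have e : Kan α n x = (-1) ^ n * Kan α n x⁻¹ := by simpa using Kan_inv hα n x⁻¹
    rw [e, Function.comp_apply, div_inv_eq_mul]
    ring
  · rw [← Kan_inv hα, inv_div]
  · obtain ⟨A, hA⟩ := exists_abs_Kan_le hα n
    obtain ⟨D, hD⟩ := exists_abs_Kan_le hα (n + 1)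
    obtain ⟨B, hB⟩ := exists_abs_mul_Kan_le hα n
    obtain ⟨E, hE⟩ := exists_abs_sq_mul_Kan_add_le hα n
    have hA0 := (abs_nonneg _).trans (hA 1 one_pos)
    have hD0 := (abs_nonneg _).trans (hD 1 one_pos)
    have hB0 := (abs_nonneg _).trans (hB 1 one_pos)
    have hE0 := (abs_nonneg _).trans (hE 1 one_pos)
    refine ⟨A + D + B + E + 1, by linarith, fun x hx => by linarith [hA x hx],
      fun x hx y hy => ?_, fun x hx y hy => ?_, fun x hx y hy => ?_⟩
    · have e : Kan α n (x / y) / y = x / y * Kan α n (x / y) / x := by field_simp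
      rw [e, abs_div, abs_of_pos hx]
      gcongr
      linarith [hB _ (div_pos hx hy)]
    · have e : -((Kan α (n + 1) (x / y) + Kan α n (x / y)) / y ^ 2) =
          -((x / y) ^ 2 * (Kan α (n + 1) (x / y) + Kan α n (x / y)) / x ^ 2) := by
        field_simp
      rw [deriv_Kan_div_div hα n x hy.ne', e, abs_neg, abs_div, abs_of_pos (pow_pos hx 2)]
      gcongr
      linarith [hE _ (div_pos hx hy)]
    · rw [deriv_Kan_div_div hα n x hy.ne', abs_neg, abs_div, abs_of_pos (pow_pos hy 2)]
      gcongr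
      linarith [hA _ (div_pos hx hy), hD _ (div_pos hx hy),
        abs_add_le (Kan α (n + 1) (x / y)) (Kan α n (x / y))]
end
end
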